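/- arXiv:1210.1684 — 2 statements merged into one kernel-verified Lean document; each statement's English description precedes it below -/
import Mathlib

section
/- Let g ≥ 1 and 1 ≤ r ≤ g. The number of Göpel groups with 2^r characteristics, i.e. the number of r-dimensional 𝔽₂-subspaces G of V = 𝔽₂^g × 𝔽₂^g on which the symplectic pairing vanishes identically, equals (2^{2g}−1)(2^{2g−2}−1)⋯(2^{2g−2r+2}−1) / ((2^r−1)(2^{r−1}−1)⋯(2−1)) = ∏_{i=1}^{r} (2^{2g−2i+2}−1)/(2^{i}−1). -/
open scoped BigOperators

open Module

namespace LinearMap.BilinForm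

variable {K V : Type*} [Field K] [AddCommGroup V] [Module K V] {B : LinearMap.BilinForm K V}

/-- Adjoining a vector to a subspace gives a totally isotropic subspace for an alternating form
exactly when the subspace is totally isotropic and the vector is orthogonal to it. -/
theorem IsAlt.span_singleton_sup_le_orthogonal_iff (hB : B.IsAlt) {W : Submodule K V} {v : V} :
    K ∙ v ⊔ W ≤ B.orthogonal (K ∙ v ⊔ W) ↔ W ≤ B.orthogonal W ∧ v ∈ B.orthogonal W := by
  constructor
  · intro h
    have hW := h.trans (B.orthogonal_le le_sup_right)
    exact ⟨le_sup_right.trans hW,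
      hW (le_sup_left (a := K ∙ v) (Submodule.mem_span_singleton_self v))⟩
  · rintro ⟨hW, hv⟩ x hx y hy
    rw [← Submodule.span_eq W, ← Submodule.span_insert, Submodule.mem_span_insert,
      Submodule.span_eq] at hx hy
    obtain ⟨a, w, hw, rfl⟩ := hx
    obtain ⟨b, u, hu, rfl⟩ := hy
    have huw : B u w = 0 := hW hw u hu
    have huv : B u v = 0 := hv u hu
    have hvw : B v w = 0 := (hB.eq_iff).1 (hv w hw)
    have hvv : B v v = 0 := hB v
    simp [huw, huv, hvw, hvv]

variable (B) in
/-- A linearly independent family spanning a totally isotropic subspace. -/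
def IsIsotropicFrame {k : ℕ} (s : Fin k → V) : Prop :=
  LinearIndependent K s ∧
    Submodule.span K (Set.range s) ≤ B.orthogonal (Submodule.span K (Set.range s))

theorem IsAlt.isIsotropicFrame_cons_iff (hB : B.IsAlt) {k : ℕ} {s : Fin k → V} {v : V} :
    B.IsIsotropicFrame (Fin.cons v s : Fin (k + 1) → V) ↔
      B.IsIsotropicFrame s ∧ v ∈ B.orthogonal (Submodule.span K (Set.range s)) ∧
        v ∉ Submodule.span K (Set.range s) := by
  rw [IsIsotropicFrame, IsIsotropicFrame, linearIndependent_finCons, Fin.range_cons,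
    Submodule.span_insert, hB.span_singleton_sup_le_orthogonal_iff]
  tauto

/-- An isotropic frame of length `k + 1` is an isotropic frame of length `k` together with a vector
orthogonal to its span and not contained in it. -/
def IsAlt.isotropicFrameSuccEquiv (hB : B.IsAlt) (k : ℕ) :
    {s : Fin (k + 1) → V // B.IsIsotropicFrame s} ≃
      Σ s : {s : Fin k → V // B.IsIsotropicFrame s},
        {v : V // v ∈ B.orthogonal (Submodule.span K (Set.range s.1)) ∧
          v ∉ Submodule.span K (Set.range s.1)} where
  toFun s :=
    have h := hB.isIsotropicFrame_cons_iff.1 ((Fin.cons_self_tail s.1).symm ▸ s.2)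
    ⟨⟨Fin.tail s.1, h.1⟩, s.1 0, h.2⟩
  invFun p := ⟨Fin.cons p.2.1 p.1.1, hB.isIsotropicFrame_cons_iff.2 ⟨p.1.2, p.2.2⟩⟩
  left_inv s := Subtype.ext (Fin.cons_self_tail s.1)
  right_inv _ := rfl

/-- An isotropic frame of length `r` is a totally isotropic subspace of dimension `r` together with
a linearly independent family of length `r` in it. -/
noncomputable def isotropicFrameEquiv [FiniteDimensional K V] (r : ℕ) :
    {s : Fin r → V // B.IsIsotropicFrame s} ≃
      Σ W : {W : Submodule K V // finrank K W = r ∧ W ≤ B.orthogonal W},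
        {t : Fin r → W.1 // LinearIndependent K t} where
  toFun s := ⟨⟨Submodule.span K (Set.range s.1), by simp [finrank_span_eq_card s.2.1], s.2.2⟩,
    fun i => ⟨s.1 i, Submodule.subset_span ⟨i, rfl⟩⟩, linearIndependent_span s.2.1⟩
  invFun p := ⟨fun i => p.2.1 i, by
    have hli := p.2.2.map' p.1.1.subtype p.1.1.ker_subtype
    have hle : Submodule.span K (Set.range fun i => (p.2.1 i : V)) ≤ p.1.1 :=
      Submodule.span_le.2 (by rintro _ ⟨i, rfl⟩; exact (p.2.1 i).2)
    exact ⟨hli, hle.trans (p.1.2.2.trans (B.orthogonal_le hle))⟩⟩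
  left_inv _ := rfl
  right_inv := by
    rintro ⟨⟨W, hW, hWo⟩, t, ht⟩
    have hli := ht.map' W.subtype W.ker_subtype
    have hfin := finrank_span_eq_card hli
    rw [Fintype.card_fin] at hfin
    have hspan : Submodule.span K (Set.range fun i => (t i : V)) = W :=
      Submodule.eq_of_le_of_finrank_eq
        (Submodule.span_le.2 (by rintro _ ⟨i, rfl⟩; exact (t i).2)) (hfin.trans hW.symm)
    have hext (p p' : Σ W : {W : Submodule K V // finrank K W = r ∧ W ≤ B.orthogonal W},
        {t : Fin r → W.1 // LinearIndependent K t}) (h : p.1.1 = p'.1.1)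
        (h' : ∀ i, (p.2.1 i : V) = p'.2.1 i) : p = p' := by
      obtain ⟨⟨W, _⟩, t, _⟩ := p
      obtain ⟨⟨W', _⟩, t', _⟩ := p'
      obtain rfl : W = W' := h
      obtain rfl : t = t' := funext fun i => Subtype.ext (h' i)
      rfl
    exact hext _ _ hspan fun _ => rfl

variable [Fintype K] [Finite V]

local notation "q" => Fintype.card K

theorem natCard_orthogonal_diff (hB : B.Nondegenerate) {W : Submodule K V}
    (hW : W ≤ B.orthogonal W) :
    Nat.card {v : V // v ∈ B.orthogonal W ∧ v ∉ W} =
      q ^ (finrank K V - finrank K W) - q ^ finrank K W := by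
  have h : Nat.card {v : V // v ∈ B.orthogonal W ∧ v ∉ W} =
      ((B.orthogonal W : Set V) \ W).ncard := rfl
  rw [h, Set.ncard_sdiff hW (Set.toFinite _), ← finrank_orthogonal hB W]
  simp only [← Nat.card_eq_fintype_card (α := K), ← Module.natCard_eq_pow_finrank]
  rfl

theorem natCard_isIsotropicFrame (hB : B.IsAlt) (hB' : B.Nondegenerate) (k : ℕ) :
    Nat.card {s : Fin k → V // B.IsIsotropicFrame s} =
      ∏ i ∈ Finset.range k, (q ^ (finrank K V - i) - q ^ i) := by
  have := Fintype.ofFinite V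
  induction k with
  | zero =>
    have h (s : Fin 0 → V) : B.IsIsotropicFrame s :=
      ⟨linearIndependent_empty_type, by simp [Set.range_eq_empty]⟩
    simp [h]
  | succ k ih =>
    classical
    have := Fintype.ofFinite {s : Fin k → V // B.IsIsotropicFrame s}
    rw [Nat.card_congr (hB.isotropicFrameSuccEquiv k), Nat.card_sigma, Finset.prod_range_succ, ← ih,
      Nat.card_eq_fintype_card, ← Finset.card_univ, ← smul_eq_mul]
    refine Finset.sum_const_nat ?_
    rintro ⟨s, hs, hso⟩ -
    rw [natCard_orthogonal_diff hB' hso, finrank_span_eq_card hs, Fintype.card_fin]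

theorem natCard_isotropic_mul (hB : B.IsAlt) (hB' : B.Nondegenerate) (r : ℕ) :
    Nat.card {W : Submodule K V // finrank K W = r ∧ W ≤ B.orthogonal W} *
        ∏ i ∈ Finset.range r, (q ^ r - q ^ i) =
      ∏ i ∈ Finset.range r, (q ^ (finrank K V - i) - q ^ i) := by
  have := Fintype.ofFinite {W : Submodule K V // finrank K W = r ∧ W ≤ B.orthogonal W}
  rw [← natCard_isIsotropicFrame hB hB', Nat.card_congr (isotropicFrameEquiv r), Nat.card_sigma,
    Nat.card_eq_fintype_card, ← Finset.card_univ]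
  refine (Finset.sum_const_nat ?_).symm
  rintro ⟨W, hW, -⟩ -
  rw [card_linearIndependent hW.ge, hW, Fin.prod_univ_eq_prod_range (fun i => q ^ r - q ^ i)]

/-- The number of `r`-dimensional totally isotropic subspaces of a symplectic space of dimension
`2 * g` over a finite field. -/
theorem natCard_isotropic (hB : B.IsAlt) (hB' : B.Nondegenerate) {g r : ℕ}
    (hV : finrank K V = 2 * g) (hr : r ≤ g) :
    (Nat.card {W : Submodule K V // finrank K W = r ∧ W ≤ B.orthogonal W} : ℚ) =
      ∏ i ∈ Finset.Icc 1 r, (((q : ℚ) ^ (2 * g - 2 * i + 2) - 1) / ((q : ℚ) ^ i - 1)) := by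
  have hq : (1 : ℚ) < q := by exact_mod_cast Fintype.one_lt_card (α := K)
  have hqn : 0 < q := Fintype.card_pos
  have hpos (i : ℕ) (hi : i ≠ 0) : (q : ℚ) ^ i - 1 ≠ 0 := (sub_pos.2 (one_lt_pow₀ hq hi)).ne'
  have hmul := congrArg (Nat.cast (R := ℚ)) (natCard_isotropic_mul hB hB' r)
  have hleft : ((∏ i ∈ Finset.range r, (q ^ r - q ^ i) : ℕ) : ℚ) =
      (∏ i ∈ Finset.range r, (q : ℚ) ^ i) * ∏ i ∈ Finset.Icc 1 r, ((q : ℚ) ^ i - 1) := by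
    rw [← Finset.Ico_add_one_right_eq_Icc, Finset.prod_Ico_eq_prod_range, add_tsub_cancel_right,
      ← Finset.prod_range_reflect (fun i => (q : ℚ) ^ (1 + i) - 1), ← Finset.prod_mul_distrib]
    push_cast
    refine Finset.prod_congr rfl fun i hi => ?_
    have hi := Finset.mem_range.1 hi
    rw [Nat.cast_sub (Nat.pow_le_pow_right hqn hi.le), mul_sub, ← pow_add]
    push_cast
    rw [show i + (1 + (r - 1 - i)) = r by lia, mul_one]
  have hright : ((∏ i ∈ Finset.range r, (q ^ (finrank K V - i) - q ^ i) : ℕ) : ℚ) =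
      (∏ i ∈ Finset.range r, (q : ℚ) ^ i) *
        ∏ i ∈ Finset.Icc 1 r, ((q : ℚ) ^ (2 * g - 2 * i + 2) - 1) := by
    rw [← Finset.Ico_add_one_right_eq_Icc, Finset.prod_Ico_eq_prod_range, add_tsub_cancel_right,
      ← Finset.prod_mul_distrib]
    push_cast
    refine Finset.prod_congr rfl fun i hi => ?_
    have hi := Finset.mem_range.1 hi
    rw [hV, Nat.cast_sub (Nat.pow_le_pow_right hqn (by lia)), mul_sub, ← pow_add]
    push_cast
    rw [show i + (2 * g - 2 * (1 + i) + 2) = 2 * g - i by lia, mul_one]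
  rw [Nat.cast_mul, hleft, hright, mul_left_comm] at hmul
  rw [Finset.prod_div_distrib, eq_div_iff
    (Finset.prod_ne_zero_iff.2 fun i hi => hpos i (by have := Finset.mem_Icc.1 hi; lia))]
  exact mul_left_cancel₀ (Finset.prod_ne_zero_iff.2 fun i _ => (pow_pos (by linarith) i).ne') hmul

end LinearMap.BilinForm

/-- The pairing `⟨(a, a'), (b, b')⟩ = aᵀb' + a'ᵀb` on `(ι → R) × (ι → R)`. -/
def syzygyForm (R ι : Type*) [CommRing R] [Fintype ι] :
    LinearMap.BilinForm R ((ι → R) × (ι → R)) :=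
  (dotProductBilin R R).compl₁₂ (LinearMap.fst R _ _) (LinearMap.snd R _ _) +
    (dotProductBilin R R).compl₁₂ (LinearMap.snd R _ _) (LinearMap.fst R _ _)

section syzygyForm

variable {R ι : Type*} [CommRing R] [Fintype ι]

theorem syzygyForm_apply (x y : (ι → R) × (ι → R)) :
    syzygyForm R ι x y = (∑ i, x.1 i * y.2 i) + (∑ i, x.2 i * y.1 i) := rfl

theorem syzygyForm_comm (x y : (ι → R) × (ι → R)) :
    syzygyForm R ι x y = syzygyForm R ι y x := by
  simp only [syzygyForm_apply, mul_comm, add_comm]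

theorem syzygyForm_isAlt [CharP R 2] : (syzygyForm R ι).IsAlt := fun x => by
  simp only [syzygyForm_apply, mul_comm (x.2 _), CharTwo.add_self_eq_zero]

theorem syzygyForm_nondegenerate : (syzygyForm R ι).Nondegenerate := by
  classical
  have h : (syzygyForm R ι).SeparatingLeft := fun x hx => by
    ext i
    · simpa [syzygyForm_apply, Pi.single_apply] using hx (0, Pi.single i 1)
    · simpa [syzygyForm_apply, Pi.single_apply] using hx (Pi.single i 1, 0)
  exact ⟨h, fun x hx => h x fun y => (syzygyForm_comm x y).trans (hx y)⟩

end syzygyForm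

/-- for `1 ≤ r ≤ g`, the number of Göpel groups with `2^r` characteristics,
i.e. of `r`-dimensional `𝔽₂`-subspaces of `V = 𝔽₂^g × 𝔽₂^g` on which the symplectic
pairing `⟨(a,a'),(b,b')⟩ = aᵀb' + a'ᵀb` vanishes identically, equals
`∏_{i=1}^{r} (2^{2g−2i+2}−1)/(2^{i}−1)`. -/
theorem card_goepel_groups (g r : ℕ) (hg : 1 ≤ g) (hr : 1 ≤ r) (hrg : r ≤ g) :
    (Nat.card {G : Submodule (ZMod 2) ((Fin g → ZMod 2) × (Fin g → ZMod 2)) //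
        Module.finrank (ZMod 2) G = r ∧
        ∀ x ∈ G, ∀ y ∈ G,
          (∑ i, x.1 i * y.2 i) + (∑ i, x.2 i * y.1 i) = 0} : ℚ) =
      ∏ i ∈ Finset.Icc 1 r, (((2 : ℚ) ^ (2 * g - 2 * i + 2) - 1) / ((2 : ℚ) ^ i - 1)) := by
  have hV : finrank (ZMod 2) ((Fin g → ZMod 2) × (Fin g → ZMod 2)) = 2 * g := by
    simp [two_mul]
  have h := LinearMap.BilinForm.natCard_isotropic (syzygyForm_isAlt (R := ZMod 2) (ι := Fin g))
    syzygyForm_nondegenerate hV hrg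
  rw [ZMod.card, Nat.cast_ofNat] at h
  rw [← h]
  refine congrArg Nat.cast (Nat.card_congr (Equiv.subtypeEquivRight fun G => and_congr_right' ?_))
  exact forall₂_congr fun x _ => forall₂_congr fun y _ => by
    rw [syzygyForm_comm y x, syzygyForm_apply]
end

section
/- Let g ≥ 1, τ ∈ 𝔥_g, and z₁, z₂ ∈ ℂ^g. For any two half-integer characteristics 𝔞 and 𝔥 one has θ[𝔞](z₁,τ)²·θ[𝔞𝔥](z₂,τ)² = (1/2^g) ∑_𝔢 exp(πi|𝔞𝔢|)·(𝔥 choose 𝔞𝔢)·θ[𝔢](z₁,τ)²·θ[𝔢𝔥](z₂,τ)², where the sum runs over all 2^{2g} half-integer characteristics 𝔢. -/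
open scoped BigOperators

/-- The theta function with rational characteristics `a, b ∈ ℚ^g`:
`θ[a;b](z,τ) = ∑_{u ∈ ℤ^g} exp(πi((u+a)ᵀτ(u+a) + 2(u+a)ᵀ(z+b)))`. -/
noncomputable def thetaChar (g : ℕ) (a b : Fin g → ℚ) (z : Fin g → ℂ)
    (τ : Matrix (Fin g) (Fin g) ℂ) : ℂ :=
  ∑' u : Fin g → ℤ, Complex.exp ((Real.pi : ℂ) * Complex.I *
    ((∑ i, ∑ j, ((u i : ℂ) + (a i : ℂ)) * τ i j * ((u j : ℂ) + (a j : ℂ))) +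
      2 * ∑ i, ((u i : ℂ) + (a i : ℂ)) * (z i + (b i : ℂ))))

/-- The theta function attached to a half-integer characteristic
`𝔪 = (1/2)(m; m')`, encoded as `m ∈ 𝔽₂^g × 𝔽₂^g` via its `0/1` representatives. -/
noncomputable def thetaHalf (g : ℕ) (m : (Fin g → ZMod 2) × (Fin g → ZMod 2))
    (z : Fin g → ℂ) (τ : Matrix (Fin g) (Fin g) ℂ) : ℂ :=
  thetaChar g (fun i => ((m.1 i).val : ℚ) / 2) (fun i => ((m.2 i).val : ℚ) / 2) z τ

/-- `|𝔪| = ∑ m_i m'_i`, computed with the `0/1` representatives. -/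
def absChar (g : ℕ) (m : (Fin g → ZMod 2) × (Fin g → ZMod 2)) : ℕ :=
  ∑ i, (m.1 i).val * (m.2 i).val

/-- `(𝔪 choose 𝔞) = exp(πi ∑_j m_j a'_j)`, computed with the `0/1` representatives. -/
noncomputable def chooseChar (g : ℕ)
    (m a : (Fin g → ZMod 2) × (Fin g → ZMod 2)) : ℂ :=
  Complex.exp ((Real.pi : ℂ) * Complex.I * ((∑ j, (m.1 j).val * (a.2 j).val : ℕ) : ℂ))

open scoped Matrix

theorem summable_prod_pi {β : Type*} (n : ℕ) (f : Fin n → β → ℝ) (hf : ∀ i, 0 ≤ f i)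
    (hs : ∀ i, Summable (f i)) : Summable fun u : Fin n → β => ∏ i, f i (u i) := by
  induction n with
  | zero => exact Summable.of_finite
  | succ n ih =>
    have h := (hs 0).mul_of_nonneg (ih (fun i => f i.succ) (fun i => hf _) fun i => hs _) (hf 0)
      fun u => Finset.prod_nonneg fun i _ => hf _ _
    refine (Fin.consEquiv fun _ => β).summable_iff.1 (h.congr fun p => ?_)
    simp [Fin.prod_univ_succ, Fin.consEquiv]

theorem Matrix.PosDef.exists_pos_mul_sum_sq_le {ι : Type*} [Fintype ι] {M : Matrix ι ι ℝ}
    (hM : M.PosDef) :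
    ∃ c : ℝ, 0 < c ∧ ∀ x : ι → ℝ, c * ∑ i, x i ^ 2 ≤ ∑ i, ∑ j, x i * M i j * x j := by
  have hpos (x : ι → ℝ) (hx : x ≠ 0) : 0 < ∑ i, ∑ j, x i * M i j * x j := by
    simpa [dotProduct, Matrix.mulVec, Finset.mul_sum, mul_assoc] using hM.dotProduct_mulVec_pos hx
  obtain ⟨c, hc, h⟩ := (isCompact_sphere (0 : EuclideanSpace ℝ ι) 1).exists_forall_le'
    (f := fun x => ∑ i, ∑ j, x i * M i j * x j) (a := 0) (by fun_prop) (fun x hx => hpos x (by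
      rintro h
      have : x = 0 := by ext i; exact congrFun h i
      simp [this] at hx))
  refine ⟨c, hc, fun x => ?_⟩
  rcases eq_or_ne x 0 with rfl | hx
  · simp
  have hx' : WithLp.toLp 2 x ≠ 0 := by simpa using hx
  have hn : 0 < ‖WithLp.toLp 2 x‖ := norm_pos_iff.2 hx'
  have hsq : ∑ i, x i ^ 2 = ‖WithLp.toLp 2 x‖ ^ 2 := by simp [EuclideanSpace.norm_sq_eq]
  have h1 := h (‖WithLp.toLp 2 x‖⁻¹ • WithLp.toLp 2 x) (by simp [norm_smul, hn.ne'])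
  rw [hsq]
  set r := ‖WithLp.toLp 2 x‖
  have h2 : ∑ i, ∑ j, (r⁻¹ • WithLp.toLp 2 x) i * M i j * (r⁻¹ • WithLp.toLp 2 x) j =
      (∑ i, ∑ j, x i * M i j * x j) / r ^ 2 := by
    simp only [Finset.sum_div, PiLp.smul_apply, smul_eq_mul]
    refine Finset.sum_congr rfl fun i _ => Finset.sum_congr rfl fun j _ => ?_
    field_simp
  rw [h2, le_div_iff₀ (by positivity)] at h1
  exact h1

/-- The general term `exp(πi(sᵀτs + 2sᵀz))` of a theta series. -/
noncomputable def gaussTerm {g : ℕ} (τ : Matrix (Fin g) (Fin g) ℂ) (z : Fin g → ℂ)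
    (s : Fin g → ℤ) : ℂ :=
  Complex.exp ((Real.pi : ℂ) * Complex.I *
    ((∑ i, ∑ j, (s i : ℂ) * τ i j * (s j : ℂ)) + 2 * ∑ i, (s i : ℂ) * z i))

theorem summable_norm_gaussTerm {g : ℕ} {τ : Matrix (Fin g) (Fin g) ℂ}
    (hpos : (τ.map Complex.im).PosDef) (z : Fin g → ℂ) :
    Summable fun s => ‖gaussTerm τ z s‖ := by
  obtain ⟨c, hc, h⟩ := hpos.exists_pos_mul_sum_sq_le
  have hs := summable_prod_pi g (fun i n => ‖jacobiTheta₂_term n (z i) (c * Complex.I)‖)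
    (fun i n => norm_nonneg _)
    fun i => ((summable_jacobiTheta₂_term_iff _ _).2 (by simpa using hc)).norm
  refine hs.of_nonneg_of_le (fun s => norm_nonneg _) fun s => ?_
  have hQ := h fun i => s i
  have him : (∑ i, ∑ j, (s i : ℂ) * τ i j * (s j : ℂ)).im =
      ∑ i, ∑ j, (s i : ℝ) * (τ.map Complex.im) i j * (s j : ℝ) := by
    simp [Complex.im_sum, Complex.mul_im, Complex.mul_re]
  have hL : (∑ i, (s i : ℂ) * z i).im = ∑ i, (s i : ℝ) * (z i).im := by
    simp [Complex.im_sum, Complex.mul_im]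
  have hn : ‖gaussTerm τ z s‖ =
      Real.exp (-Real.pi * ((∑ i, ∑ j, (s i : ℝ) * (τ.map Complex.im) i j * (s j : ℝ)) +
        2 * ∑ i, (s i : ℝ) * (z i).im)) := by
    rw [gaussTerm, Complex.norm_exp, ← him, ← hL]
    congr 1
    simp [Complex.mul_re, Complex.mul_im]
  simp only [norm_jacobiTheta₂_term]
  rw [hn, ← Real.exp_sum, Real.exp_le_exp]
  have : ∑ i, (-Real.pi * (s i : ℝ) ^ 2 * (c * Complex.I).im - 2 * Real.pi * s i * (z i).im) =
      -Real.pi * (c * ∑ i, (s i : ℝ) ^ 2 + 2 * ∑ i, (s i : ℝ) * (z i).im) := by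
    simp only [Finset.mul_sum, ← Finset.sum_add_distrib]
    refine Finset.sum_congr rfl fun i _ => ?_
    simp
    ring
  rw [this]
  nlinarith [Real.pi_pos]

theorem gaussTerm_mul {g : ℕ} (τ : Matrix (Fin g) (Fin g) ℂ) (z : Fin g → ℂ) (s d : Fin g → ℤ) :
    gaussTerm τ z (s + d) * gaussTerm τ z (s - d) =
      gaussTerm ((2 : ℂ) • τ) ((2 : ℂ) • z) s * gaussTerm ((2 : ℂ) • τ) 0 d := by
  simp only [gaussTerm, ← Complex.exp_add, ← mul_add]
  congr 2
  simp only [Finset.mul_sum, ← Finset.sum_add_distrib]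
  refine Finset.sum_congr rfl fun i _ => ?_
  simp only [Pi.add_apply, Pi.sub_apply, Matrix.smul_apply, Pi.smul_apply, Pi.zero_apply,
    smul_eq_mul, Int.cast_add, Int.cast_sub]
  have : ∑ j, ((s i : ℂ) + d i) * τ i j * (s j + d j) + ∑ j, ((s i : ℂ) - d i) * τ i j * (s j - d j)
    = ∑ j, (s i : ℂ) * (2 * τ i j) * s j + ∑ j, (d i : ℂ) * (2 * τ i j) * d j := by
    simp only [← Finset.sum_add_distrib]
    exact Finset.sum_congr rfl fun j _ => by ring
  linear_combination this

/-- The nontrivial sign character of `ℤ/2`. -/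
def parity (x : ZMod 2) : ℂ := (-1) ^ x.val

theorem parity_zero : parity 0 = 1 := by simp [parity]

theorem parity_one : parity 1 = -1 := by simp [parity, ZMod.val_one]

theorem parity_add (x y : ZMod 2) : parity (x + y) = parity x * parity y := by
  obtain rfl | rfl : x = 0 ∨ x = 1 := by revert x; decide
  · simp [parity_zero]
  obtain rfl | rfl : y = 0 ∨ y = 1 := by revert y; decide
  · simp [parity_zero]
  · simp [parity_one, CharTwo.add_self_eq_zero, parity_zero]

theorem parity_sum {ι : Type*} (s : Finset ι) (f : ι → ZMod 2) :
    parity (∑ i ∈ s, f i) = ∏ i ∈ s, parity (f i) := by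
  classical
  induction s using Finset.induction_on with
  | empty => simp [parity_zero]
  | insert i s hi ih => rw [Finset.sum_insert hi, Finset.prod_insert hi, parity_add, ih]

theorem exp_pi_mul_I_mul_int (n : ℤ) :
    Complex.exp ((Real.pi : ℂ) * Complex.I * n) = parity (n : ZMod 2) := by
  rw [mul_comm, Complex.exp_int_mul, Complex.exp_pi_mul_I]
  rcases Int.even_or_odd n with h | h
  · rw [h.neg_one_zpow, (ZMod.intCast_eq_zero_iff_even).2 h, parity_zero]
  · rw [h.neg_one_zpow, (ZMod.intCast_eq_one_iff_odd).2 h, parity_one]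

theorem sum_parity_dotProduct {g : ℕ} (k : Fin g → ZMod 2) :
    ∑ e : Fin g → ZMod 2, parity (k ⬝ᵥ e) = if k = 0 then 2 ^ g else 0 := by
  simp only [dotProduct, parity_sum]
  rw [← Fintype.prod_sum fun i x => parity (k i * x)]
  have hfac (y : ZMod 2) : ∑ x, parity (y * x) = if y = 0 then 2 else 0 := by
    have huniv : (Finset.univ : Finset (ZMod 2)) = {0, 1} := rfl
    rw [huniv, Finset.sum_pair (by decide)]
    obtain rfl | rfl : y = 0 ∨ y = 1 := by revert y; decide
    · simp [parity_zero]; norm_num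
    · simp [parity_zero, parity_one]
  simp only [hfac]
  split_ifs with h
  · simp [h]
  · obtain ⟨i, hi⟩ := Function.ne_iff.1 h
    exact Finset.prod_eq_zero (Finset.mem_univ i) (by simpa using hi)

/-- The part of the theta series with period matrix `τ / 2` supported on a class modulo `2`. -/
noncomputable def thetaClass {g : ℕ} (τ : Matrix (Fin g) (Fin g) ℂ) (z : Fin g → ℂ)
    (c : Fin g → ZMod 2) : ℂ :=
  ∑' s : Fin g → ℤ, if (fun i => (s i : ZMod 2)) = c then
    gaussTerm ((1 / 2 : ℂ) • τ) z s else 0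

theorem posDef_map_im_smul {g : ℕ} {τ : Matrix (Fin g) (Fin g) ℂ}
    (hpos : (τ.map Complex.im).PosDef) {r : ℝ} (hr : 0 < r) :
    (((r : ℂ) • τ).map Complex.im).PosDef := by
  have : ((r : ℂ) • τ).map Complex.im = r • τ.map Complex.im := by
    ext i j
    simp [Complex.mul_im]
  rw [this]
  exact hpos.smul hr

theorem thetaHalf_eq_tsum_gaussTerm {g : ℕ} (m : (Fin g → ZMod 2) × (Fin g → ZMod 2))
    (z : Fin g → ℂ) (τ : Matrix (Fin g) (Fin g) ℂ) :
    thetaHalf g m z τ = ∑' u : Fin g → ℤ, gaussTerm ((1 / 4 : ℂ) • τ)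
      ((1 / 2 : ℂ) • fun i => z i + (m.2 i).val / 2) (fun i => 2 * u i + (m.1 i).val) := by
  rw [thetaHalf, thetaChar]
  refine tsum_congr fun u => ?_
  rw [gaussTerm]
  congr 3
  · refine Finset.sum_congr rfl fun i _ => Finset.sum_congr rfl fun j _ => ?_
    simp [-ZMod.natCast_val]
    ring
  · congr 1
    refine Finset.sum_congr rfl fun i _ => ?_
    simp [-ZMod.natCast_val]
    ring

theorem gaussTerm_add_half {g : ℕ} (τ : Matrix (Fin g) (Fin g) ℂ) (z : Fin g → ℂ)
    (m : Fin g → ZMod 2) (s : Fin g → ℤ) :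
    gaussTerm τ (fun i => z i + (m i).val / 2) s =
      parity ((fun i => (s i : ZMod 2)) ⬝ᵥ m) * gaussTerm τ z s := by
  have h : ((∑ i, s i * (m i).val : ℤ) : ZMod 2) = (fun i => (s i : ZMod 2)) ⬝ᵥ m := by
    simp [dotProduct]
  rw [← h, ← exp_pi_mul_I_mul_int, gaussTerm, gaussTerm, ← Complex.exp_add]
  congr 1
  have h2 : 2 * ∑ i, (s i : ℂ) * (z i + (m i).val / 2) =
      ((∑ i, s i * (m i).val : ℤ) : ℂ) + 2 * ∑ i, (s i : ℂ) * z i := by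
    push_cast
    simp only [Finset.mul_sum, ← Finset.sum_add_distrib]
    exact Finset.sum_congr rfl fun i _ => by ring
  rw [h2]
  ring

theorem summable_norm_gaussTerm_class {g : ℕ} {τ : Matrix (Fin g) (Fin g) ℂ}
    (hpos : (τ.map Complex.im).PosDef) (z : Fin g → ℂ) (c : Fin g → ZMod 2) :
    Summable fun s : Fin g → ℤ => ‖if (fun i => (s i : ZMod 2)) = c then
      gaussTerm ((1 / 2 : ℂ) • τ) z s else 0‖ := by
  have h := summable_norm_gaussTerm (posDef_map_im_smul hpos (r := 1 / 2) (by norm_num)) z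
  refine h.of_nonneg_of_le (fun s => norm_nonneg _) fun s => ?_
  split_ifs <;> simp

theorem injective_two_mul_add {g : ℕ} (m : Fin g → ℤ) :
    Function.Injective fun u : Fin g → ℤ => fun i => 2 * u i + m i := by
  intro u v h
  ext i
  have := congrFun h i
  simp only at this
  omega

theorem thetaHalf_sq {g : ℕ} {τ : Matrix (Fin g) (Fin g) ℂ}
    (hpos : (τ.map Complex.im).PosDef) (z : Fin g → ℂ)
    (m : (Fin g → ZMod 2) × (Fin g → ZMod 2)) :
    thetaHalf g m z τ ^ 2 =
      ∑ c, parity (c ⬝ᵥ m.2) * thetaClass τ z c * thetaClass τ 0 (c + m.1) := by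
  classical
  set w : Fin g → ℂ := fun i => z i + (m.2 i).val / 2 with hw
  have hsum : Summable fun u : Fin g → ℤ => ‖gaussTerm ((1 / 4 : ℂ) • τ) ((1 / 2 : ℂ) • w)
      (fun i => 2 * u i + (m.1 i).val)‖ := by
    have h := summable_norm_gaussTerm (posDef_map_im_smul hpos (r := 1 / 4) (by norm_num))
      ((1 / 2 : ℂ) • w)
    simpa [Function.comp_def] using
      h.comp_injective (injective_two_mul_add fun i => ((m.1 i).val : ℤ))
  rw [thetaHalf_eq_tsum_gaussTerm, sq, tsum_mul_tsum_of_summable_norm hsum hsum]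
  simp only [thetaClass, mul_assoc]
  have hc (c : Fin g → ZMod 2) := tsum_mul_tsum_of_summable_norm
    (summable_norm_gaussTerm_class hpos z c) (summable_norm_gaussTerm_class hpos 0 (c + m.1))
  have hcs (c : Fin g → ZMod 2) := (summable_mul_of_summable_norm
    (summable_norm_gaussTerm_class hpos z c) (summable_norm_gaussTerm_class hpos 0 (c + m.1)))
  simp only [hc, ← tsum_mul_left]
  rw [← Summable.tsum_finsetSum fun c _ => (hcs c).mul_left _]
  simp only [ite_mul, mul_ite, zero_mul, mul_zero]
  have hinj : Function.Injective fun p : (Fin g → ℤ) × (Fin g → ℤ) =>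
      ((fun i => p.1 i + p.2 i + (m.1 i).val, fun i => p.1 i - p.2 i) :
        (Fin g → ℤ) × (Fin g → ℤ)) := by
    rintro ⟨u, v⟩ ⟨u', v'⟩ h
    simp only [Prod.mk.injEq, funext_iff] at h ⊢
    exact ⟨fun i => by have := h.1 i; have := h.2 i; omega,
      fun i => by have := h.1 i; have := h.2 i; omega⟩
  refine Eq.trans ?_ (hinj.tsum_eq ?_)
  · refine tsum_congr fun p => ?_
    set s : Fin g → ℤ := fun i => p.1 i + p.2 i + (m.1 i).val with hs
    set d : Fin g → ℤ := fun i => p.1 i - p.2 i with hd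
    have hcong : (fun i => (d i : ZMod 2)) = (fun i => (s i : ZMod 2)) + m.1 := by
      ext i
      simp only [hs, hd, Pi.add_apply, Int.cast_add, Int.cast_sub, Int.cast_natCast,
        ZMod.natCast_zmod_val]
      rw [add_assoc, CharTwo.add_self_eq_zero, add_zero, CharTwo.sub_eq_add]
    have h1 : (fun i => 2 * p.1 i + ((m.1 i).val : ℤ)) = s + d := by
      ext i; simp [hs, hd]; ring
    have h2 : (fun i => 2 * p.2 i + ((m.1 i).val : ℤ)) = s - d := by
      ext i; simp [hs, hd]; ring
    rw [h1, h2, gaussTerm_mul, smul_smul, smul_smul, Finset.sum_eq_single fun i => (s i : ZMod 2)]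
    · rw [if_pos rfl, if_pos hcong, ← mul_assoc, ← gaussTerm_add_half, ← hw]
      norm_num
    · intro c _ hcne
      rw [if_neg hcne.symm]
      simp
    · simp
  · intro p hp
    obtain ⟨c, -, hc0⟩ := Finset.exists_ne_zero_of_sum_ne_zero hp
    have hc1 : (fun i => (p.1 i : ZMod 2)) = c := by
      by_contra h
      simp [h] at hc0
    have hc2 : (fun i => (p.2 i : ZMod 2)) = c + m.1 := by
      by_contra h
      simp [h] at hc0
    have hdvd (i : Fin g) : (2 : ℤ) ∣ p.1 i + p.2 i + (m.1 i).val := by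
      rw [← Nat.cast_two, ← ZMod.intCast_zmod_eq_zero_iff_dvd _ 2]
      have e1 := congrFun hc1 i
      have e2 := congrFun hc2 i
      simp only [Pi.add_apply] at e1 e2
      simp only [Int.cast_add, Int.cast_natCast, ZMod.natCast_zmod_val, e1, e2]
      rw [show c i + (c i + m.1 i) + m.1 i = (c i + c i) + (m.1 i + m.1 i) by ring,
        CharTwo.add_self_eq_zero, CharTwo.add_self_eq_zero, add_zero]
    choose k hk using hdvd
    refine ⟨(fun i => k i - (m.1 i).val, fun i => k i - (m.1 i).val - p.2 i), ?_⟩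
    ext i
    · have := hk i
      simp only
      omega
    · have := hk i
      simp only
      omega

/-- The finite Fourier inversion behind Baker's identity. -/
theorem sum_parity_mul_sum_eq {g : ℕ} (A A' B : (Fin g → ZMod 2) → ℂ)
    (a h : (Fin g → ZMod 2) × (Fin g → ZMod 2)) :
    (∑ c, parity (c ⬝ᵥ a.2) * A c * B (c + a.1)) *
        (∑ d, parity (d ⬝ᵥ (a + h).2) * A' d * B (d + (a + h).1)) =
      (1 / 2 ^ g : ℂ) * ∑ e : (Fin g → ZMod 2) × (Fin g → ZMod 2),
        parity ((a + e).1 ⬝ᵥ (a + e).2) * parity (h.1 ⬝ᵥ (a + e).2) *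
          (∑ c, parity (c ⬝ᵥ e.2) * A c * B (c + e.1)) *
          (∑ d, parity (d ⬝ᵥ (e + h).2) * A' d * B (d + (e + h).1)) := by
  have hself (x : Fin g → ZMod 2) : x + x = 0 :=
    funext fun i => CharTwo.add_self_eq_zero (x i)
  have hexpand : ∀ e : (Fin g → ZMod 2) × (Fin g → ZMod 2),
      parity ((a + e).1 ⬝ᵥ (a + e).2) * parity (h.1 ⬝ᵥ (a + e).2) *
          (∑ c, parity (c ⬝ᵥ e.2) * A c * B (c + e.1)) *
          (∑ d, parity (d ⬝ᵥ (e + h).2) * A' d * B (d + (e + h).1)) =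
      ∑ c, ∑ d, parity ((a.1 + e.1 + h.1) ⬝ᵥ a.2) * parity (d ⬝ᵥ h.2) * A c * A' d *
        B (c + e.1) * B (d + e.1 + h.1) * parity ((a.1 + h.1 + c + d + e.1) ⬝ᵥ e.2) := by
    intro e
    rw [mul_assoc, Finset.sum_mul_sum, Finset.mul_sum]
    refine Finset.sum_congr rfl fun c _ => ?_
    rw [Finset.mul_sum]
    refine Finset.sum_congr rfl fun d _ => ?_
    simp only [Prod.fst_add, Prod.snd_add, add_dotProduct, dotProduct_add, parity_add, add_assoc]
    ring
  have hinner (c d : Fin g → ZMod 2) :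
      ∑ e : (Fin g → ZMod 2) × (Fin g → ZMod 2),
        parity ((a.1 + e.1 + h.1) ⬝ᵥ a.2) * parity (d ⬝ᵥ h.2) * A c * A' d *
          B (c + e.1) * B (d + e.1 + h.1) * parity ((a.1 + h.1 + c + d + e.1) ⬝ᵥ e.2) =
      2 ^ g * ((parity (c ⬝ᵥ a.2) * A c * B (c + a.1)) *
        (parity (d ⬝ᵥ (a + h).2) * A' d * B (d + (a + h).1))) := by
    rw [Fintype.sum_prod_type]
    simp only [← Finset.mul_sum, sum_parity_dotProduct]
    rw [Finset.sum_eq_single (a.1 + h.1 + c + d)]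
    · rw [if_pos (hself _)]
      have e1 : c + (a.1 + h.1 + c + d) = d + (a + h).1 := by
        rw [Prod.fst_add]; linear_combination hself c
      have e2 : d + (a.1 + h.1 + c + d) + h.1 = c + a.1 := by
        linear_combination hself d + hself h.1
      have e3 : a.1 + (a.1 + h.1 + c + d) + h.1 = c + d := by
        linear_combination hself a.1 + hself h.1
      rw [e1, e2, e3, Prod.snd_add]
      simp only [add_dotProduct, dotProduct_add, parity_add]
      ring
    · intro e _ he
      rw [if_neg, mul_zero]
      intro h0
      exact he (by linear_combination h0 - hself (a.1 + h.1 + c + d))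
    · simp
  rw [Finset.sum_congr rfl fun e _ => hexpand e, Finset.sum_comm, Finset.sum_mul_sum,
    Finset.mul_sum]
  refine Finset.sum_congr rfl fun c _ => ?_
  rw [Finset.sum_comm, Finset.mul_sum]
  refine Finset.sum_congr rfl fun d _ => ?_
  rw [hinner]
  field_simp

theorem exp_absChar (g : ℕ) (m : (Fin g → ZMod 2) × (Fin g → ZMod 2)) :
    Complex.exp ((Real.pi : ℂ) * Complex.I * ((absChar g m : ℕ) : ℂ)) = parity (m.1 ⬝ᵥ m.2) := by
  have := exp_pi_mul_I_mul_int (absChar g m)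
  rw [Int.cast_natCast, Int.cast_natCast] at this
  rw [this]
  simp [absChar, dotProduct]

theorem chooseChar_eq_parity (g : ℕ) (m a : (Fin g → ZMod 2) × (Fin g → ZMod 2)) :
    chooseChar g m a = parity (m.1 ⬝ᵥ a.2) :=
  exp_absChar g (m.1, a.2)

/-- Baker's identity: for any two half-integer characteristics `𝔞` and `𝔥`,
`θ[𝔞](z₁,τ)²·θ[𝔞𝔥](z₂,τ)² = 2^{-g} ∑_𝔢 e^{πi|𝔞𝔢|} (𝔥 choose 𝔞𝔢) θ[𝔢](z₁,τ)²·θ[𝔢𝔥](z₂,τ)²`,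
the sum running over all `2^{2g}` half-integer characteristics `𝔢`. -/
theorem baker_theta_identity (g : ℕ) (hg : 1 ≤ g)
    (τ : Matrix (Fin g) (Fin g) ℂ) (hsym : τ.IsSymm)
    (hpos : (τ.map Complex.im).PosDef)
    (z₁ z₂ : Fin g → ℂ) (a h : (Fin g → ZMod 2) × (Fin g → ZMod 2)) :
    thetaHalf g a z₁ τ ^ 2 * thetaHalf g (a + h) z₂ τ ^ 2 =
      (1 / 2 ^ g : ℂ) * ∑ e : (Fin g → ZMod 2) × (Fin g → ZMod 2),
        Complex.exp ((Real.pi : ℂ) * Complex.I * ((absChar g (a + e) : ℕ) : ℂ)) *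
          chooseChar g h (a + e) *
          thetaHalf g e z₁ τ ^ 2 * thetaHalf g (e + h) z₂ τ ^ 2 := by
  simp only [exp_absChar, chooseChar_eq_parity, thetaHalf_sq hpos]
  exact sum_parity_mul_sum_eq _ _ _ _ _
end
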